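/- arXiv:2503.18517 — 4 statements merged into one kernel-verified Lean document; each statement's English description precedes it below -/
import Mathlib

section
/- Let a/c and b/d be elements of ℚ(H₄) (with c, d > 0) such that |a·d − b·c| = 1. If p/q ∈ ℚ(H₄) lies strictly between a/c and b/d, then q ≥ c + d. -/
/-- A matrix (p, r; q, s) has the first H4 form (without sign). -/
def H4form (p r q s : ℝ) : Prop :=
  (∃ a b c d : ℤ, Odd a ∧ Odd d ∧ a * d - 2 * b * c = 1 ∧
     p = (a : ℝ) ∧ r = Real.sqrt 2 * b ∧ q = Real.sqrt 2 * c ∧ s = (d : ℝ)) ∨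
  (∃ a b c d : ℤ, Odd b ∧ Odd c ∧ 2 * a * d - b * c = 1 ∧
     p = Real.sqrt 2 * a ∧ r = (b : ℝ) ∧ q = (c : ℝ) ∧ s = Real.sqrt 2 * d)

/-- The matrix (p, r; q, s) belongs to the Hecke group H4 (up to sign). -/
def H4 (p r q s : ℝ) : Prop := H4form p r q s ∨ H4form (-p) (-r) (-q) (-s)

/-- p/q ∈ ℚ(H₄): q > 0 and (p, r; q, s) ∈ H₄ for some reals r, s. -/
def QH4 (p q : ℝ) : Prop := 0 < q ∧ ∃ r s : ℝ, H4 p r q s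

/-- α ∉ √2·ℚ. -/
def NotSqrt2Rat (α : ℝ) : Prop := ¬ ∃ x : ℚ, α = Real.sqrt 2 * (x : ℝ)

/-- Up to the factor `√2` in one coordinate, a column of a matrix in `H4` is integral. -/
theorem QH4.exists_int {p q : ℝ} (h : QH4 p q) :
    (∃ m n : ℤ, p = m ∧ q = Real.sqrt 2 * n) ∨ (∃ m n : ℤ, p = Real.sqrt 2 * m ∧ q = n) := by
  obtain ⟨-, r, s, (⟨x, y, z, w, -, -, -, hp, -, hq, -⟩ | ⟨x, y, z, w, -, -, -, hp, -, hq, -⟩) |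
    (⟨x, y, z, w, -, -, -, hp, -, hq, -⟩ | ⟨x, y, z, w, -, -, -, hp, -, hq, -⟩)⟩ := h
  · exact Or.inl ⟨x, z, hp, hq⟩
  · exact Or.inr ⟨x, z, hp, hq⟩
  · exact Or.inl ⟨-x, -z, by push_cast; linarith, by push_cast; linarith⟩
  · exact Or.inr ⟨-x, -z, by push_cast; linarith, by push_cast; linarith⟩

theorem one_le_intCast_of_pos {k : ℤ} (h : (0 : ℝ) < k) : (1 : ℝ) ≤ k := by
  exact_mod_cast Int.add_one_le_iff.mpr (Int.cast_pos.mp h)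

theorem one_le_sqrt_two_mul_intCast_of_pos {k : ℤ} (h : 0 < Real.sqrt 2 * k) :
    1 ≤ Real.sqrt 2 * k := by
  have h2 : 1 ≤ Real.sqrt 2 := Real.one_le_sqrt.mpr one_le_two
  have hk : (1 : ℝ) ≤ k := one_le_intCast_of_pos (pos_of_mul_pos_right h (by positivity))
  nlinarith

/-- A positive determinant of two columns of matrices in `H4` is at least `1`. -/
theorem QH4.one_le_det_of_pos {p q a c : ℝ} (hpq : QH4 p q) (hac : QH4 a c)
    (h : 0 < p * c - a * q) : 1 ≤ p * c - a * q := by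
  have h2 : Real.sqrt 2 * Real.sqrt 2 = 2 := Real.mul_self_sqrt zero_le_two
  rcases hpq.exists_int with ⟨m, n, rfl, rfl⟩ | ⟨m, n, rfl, rfl⟩ <;>
    rcases hac.exists_int with ⟨x, y, rfl, rfl⟩ | ⟨x, y, rfl, rfl⟩
  · have e : (m : ℝ) * (Real.sqrt 2 * y) - x * (Real.sqrt 2 * n)
        = Real.sqrt 2 * (m * y - x * n : ℤ) := by push_cast; ring
    rw [e] at h ⊢
    exact one_le_sqrt_two_mul_intCast_of_pos h
  · have e : (m : ℝ) * y - Real.sqrt 2 * x * (Real.sqrt 2 * n)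
        = (m * y - 2 * x * n : ℤ) := by push_cast; linear_combination (-x * n : ℝ) * h2
    rw [e] at h ⊢
    exact one_le_intCast_of_pos h
  · have e : Real.sqrt 2 * m * (Real.sqrt 2 * y) - x * n
        = (2 * m * y - x * n : ℤ) := by push_cast; linear_combination (m * y : ℝ) * h2
    rw [e] at h ⊢
    exact one_le_intCast_of_pos h
  · have e : Real.sqrt 2 * m * y - Real.sqrt 2 * x * n
        = Real.sqrt 2 * (m * y - x * n : ℤ) := by push_cast; ring
    rw [e] at h ⊢
    exact one_le_sqrt_two_mul_intCast_of_pos h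

theorem QH4.add_le_of_lt_of_lt {a c b d p q : ℝ} (hac : QH4 a c) (hbd : QH4 b d)
    (hdet : |a * d - b * c| = 1) (hpq : QH4 p q) (hl : a / c < p / q) (hr : p / q < b / d) :
    c + d ≤ q := by
  have hc := hac.1
  have hd := hbd.1
  have hq := hpq.1
  have hlr := hl.trans hr
  rw [div_lt_div_iff₀ hc hd] at hlr
  rw [div_lt_div_iff₀ hc hq] at hl
  rw [div_lt_div_iff₀ hq hd] at hr
  have hu := hpq.one_le_det_of_pos hac (sub_pos.mpr hl)
  have hv := hbd.one_le_det_of_pos hpq (sub_pos.mpr hr)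
  rw [abs_of_neg (sub_neg.mpr hlr)] at hdet
  calc c + d ≤ (b * q - p * d) * c + (p * c - a * q) * d := by nlinarith
    _ = q := by linear_combination q * hdet

theorem denominator_bound (a c b d p q : ℝ)
    (hac : QH4 a c) (hbd : QH4 b d) (hdet : |a * d - b * c| = 1)
    (hpq : QH4 p q)
    (hbetween : (a / c < p / q ∧ p / q < b / d) ∨ (b / d < p / q ∧ p / q < a / c)) :
    c + d ≤ q := by
  rcases hbetween with ⟨hl, hr⟩ | ⟨hl, hr⟩
  · exact hac.add_le_of_lt_of_lt hbd hdet hpq hl hr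
  · rw [add_comm]
    exact hbd.add_le_of_lt_of_lt hac (by rwa [abs_sub_comm]) hpq hl hr
end

section
/- Let α > 0 be a real number with α ∉ √2·ℚ, with H₄-expansion data G_n = (t_n, v_n; u_n, w_n), and let m = m(α). If p/q ∈ ℚ(H₄) is an H₄-best approximation of α, then p/q = t_n/u_n or p/q = v_n/w_n for some n ≥ m+1. -/
/-- p/q ∈ ℚ(H₄) is an H₄-best approximation of α. -/
def IsBest (α p q : ℝ) : Prop :=
  QH4 p q ∧ ∀ r s : ℝ, QH4 r s → r / s ≠ p / q → s ≤ q → |q * α - p| < |s * α - r|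

/-- The matrices A₁, A₂, A₃ generating the H₄-expansion. -/
noncomputable def Amat : ℕ → Matrix (Fin 2) (Fin 2) ℝ
  | 1 => !![1, 0; Real.sqrt 2, 1]
  | 2 => !![Real.sqrt 2, 1; 1, Real.sqrt 2]
  | _ => !![1, Real.sqrt 2; 0, 1]

/-- G_n = A_{d₁} ⋯ A_{d_n}. -/
noncomputable def Gmat (d : ℕ → ℕ) (n : ℕ) : Matrix (Fin 2) (Fin 2) ℝ :=
  ((List.range n).map (fun i => Amat (d (i + 1)))).prod

noncomputable def tn (d : ℕ → ℕ) (n : ℕ) : ℝ := Gmat d n 0 0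
noncomputable def vn (d : ℕ → ℕ) (n : ℕ) : ℝ := Gmat d n 0 1
noncomputable def un (d : ℕ → ℕ) (n : ℕ) : ℝ := Gmat d n 1 0
noncomputable def wn (d : ℕ → ℕ) (n : ℕ) : ℝ := Gmat d n 1 1

/-- α_n = G_n⁻¹ · α. -/
noncomputable def alphan (d : ℕ → ℕ) (α : ℝ) (n : ℕ) : ℝ :=
  (wn d n * α - vn d n) / (tn d n - un d n * α)

/-- α*_n = w_n / u_n. -/
noncomputable def alphast (d : ℕ → ℕ) (n : ℕ) : ℝ := wn d n / un d n

/-- Columns of `H₄`-matrices, described by coprimality. -/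
def IsColumn (x y : ℝ) : Prop :=
  (∃ a b : ℤ, IsCoprime a (2 * b) ∧ x = a ∧ y = Real.sqrt 2 * b) ∨
  (∃ a b : ℤ, IsCoprime (2 * a) b ∧ x = Real.sqrt 2 * a ∧ y = b)

lemma sqrt_two_mul_self : Real.sqrt 2 * Real.sqrt 2 = 2 :=
  Real.mul_self_sqrt (by norm_num)

lemma one_lt_sqrt_two : 1 < Real.sqrt 2 := by
  nlinarith [sqrt_two_mul_self, Real.sqrt_nonneg 2]

lemma sqrt_two_lt_two : Real.sqrt 2 < 2 := by
  nlinarith [sqrt_two_mul_self, Real.sqrt_nonneg 2]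

namespace IsColumn

variable {x y : ℝ}

lemma swap (h : IsColumn x y) : IsColumn y x := by
  rcases h with ⟨a, b, h, hx, hy⟩ | ⟨a, b, h, hx, hy⟩
  · exact Or.inr ⟨b, a, h.symm, hy, hx⟩
  · exact Or.inl ⟨b, a, h.symm, hy, hx⟩

lemma neg (h : IsColumn x y) : IsColumn (-x) (-y) := by
  rcases h with ⟨a, b, h, rfl, rfl⟩ | ⟨a, b, h, rfl, rfl⟩
  · exact Or.inl ⟨-a, -b, by simpa using h.neg_neg, by push_cast; ring, by push_cast; ring⟩
  · exact Or.inr ⟨-a, -b, by simpa using h.neg_neg, by push_cast; ring, by push_cast; ring⟩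

lemma of_H4form {p r q s : ℝ} (h : H4form p r q s) : IsColumn p q := by
  rcases h with ⟨a, b, c, d, -, -, h, hp, -, hq, -⟩ | ⟨a, b, c, d, -, -, h, hp, -, hq, -⟩
  · exact Or.inl ⟨a, c, ⟨d, -b, by linear_combination h⟩, hp, hq⟩
  · exact Or.inr ⟨a, c, ⟨d, -b, by linear_combination h⟩, hp, hq⟩

lemma of_QH4 {p q : ℝ} (h : QH4 p q) : IsColumn p q := by
  obtain ⟨-, r, s, h | h⟩ := h
  · exact of_H4form h
  · simpa using (of_H4form h).neg

lemma qH4 (h : IsColumn x y) (hy : 0 < y) : QH4 x y := by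
  refine ⟨hy, ?_⟩
  rcases h with ⟨a, b, ⟨e, f, h⟩, hx, hy⟩ | ⟨a, b, ⟨e, f, h⟩, hx, hy⟩
  · have hodd : Odd (e * a) := ⟨-(f * b), by linear_combination h⟩
    rw [Int.odd_mul] at hodd
    exact ⟨_, _, Or.inl (Or.inl ⟨a, -f, b, e, hodd.2, hodd.1, by linear_combination h,
      hx, rfl, hy, rfl⟩)⟩
  · have hodd : Odd (f * b) := ⟨-(e * a), by linear_combination h⟩
    rw [Int.odd_mul] at hodd
    exact ⟨_, _, Or.inl (Or.inr ⟨a, -f, b, e, hodd.1.neg, hodd.2, by linear_combination h,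
      hx, rfl, hy, rfl⟩)⟩

lemma add_right (h : IsColumn x y) : IsColumn x (Real.sqrt 2 * x + y) := by
  rcases h with ⟨a, b, ⟨e, f, h⟩, rfl, rfl⟩ | ⟨a, b, ⟨e, f, h⟩, rfl, rfl⟩
  · exact Or.inl ⟨a, a + b, ⟨e - 2 * f, f, by linear_combination h⟩, rfl, by push_cast; ring⟩
  · exact Or.inr ⟨a, 2 * a + b, ⟨e - f, f, by linear_combination h⟩, rfl, by
      push_cast; linear_combination (a : ℝ) * sqrt_two_mul_self⟩

lemma sub_right (h : IsColumn x y) : IsColumn x (y - Real.sqrt 2 * x) := by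
  rcases h with ⟨a, b, ⟨e, f, h⟩, rfl, rfl⟩ | ⟨a, b, ⟨e, f, h⟩, rfl, rfl⟩
  · exact Or.inl ⟨a, b - a, ⟨e + 2 * f, f, by linear_combination h⟩, rfl, by push_cast; ring⟩
  · exact Or.inr ⟨a, b - 2 * a, ⟨e + f, f, by linear_combination h⟩, rfl, by
      push_cast; linear_combination -(a : ℝ) * sqrt_two_mul_self⟩

lemma add_left (h : IsColumn x y) : IsColumn (x + Real.sqrt 2 * y) y := by
  simpa [add_comm] using h.swap.add_right.swap

lemma sub_left (h : IsColumn x y) : IsColumn (x - Real.sqrt 2 * y) y :=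
  h.swap.sub_right.swap

lemma mix (h : IsColumn x y) :
    IsColumn (Real.sqrt 2 * x + y) (x + Real.sqrt 2 * y) := by
  rcases h with ⟨a, b, ⟨e, f, h⟩, rfl, rfl⟩ | ⟨a, b, ⟨e, f, h⟩, rfl, rfl⟩
  · exact Or.inr ⟨a + b, a + 2 * b, ⟨e - f, 2 * f - e, by linear_combination h⟩, by
      push_cast; ring, by push_cast; linear_combination (b : ℝ) * sqrt_two_mul_self⟩
  · exact Or.inl ⟨2 * a + b, a + b, ⟨2 * e - f, f - e, by linear_combination h⟩, by
      push_cast; linear_combination (a : ℝ) * sqrt_two_mul_self, by push_cast; ring⟩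

lemma unmix (h : IsColumn x y) :
    IsColumn (Real.sqrt 2 * x - y) (Real.sqrt 2 * y - x) := by
  rcases h with ⟨a, b, ⟨e, f, h⟩, rfl, rfl⟩ | ⟨a, b, ⟨e, f, h⟩, rfl, rfl⟩
  · exact Or.inr ⟨a - b, 2 * b - a, ⟨e + f, 2 * f + e, by linear_combination h⟩, by
      push_cast; ring, by push_cast; linear_combination (b : ℝ) * sqrt_two_mul_self⟩
  · exact Or.inl ⟨2 * a - b, b - a, ⟨2 * e + f, f + e, by linear_combination h⟩, by
      push_cast; linear_combination (a : ℝ) * sqrt_two_mul_self, by push_cast; ring⟩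

lemma zero_one : IsColumn 0 1 := Or.inr ⟨0, 1, isCoprime_one_right, by simp, by simp⟩

lemma one_sqrt_two : IsColumn 1 (Real.sqrt 2) := Or.inl ⟨1, 1, by simp, by simp, by simp⟩

lemma eq_one_or_sqrt_two_le (h : IsColumn x y) (hy : 0 < y) : y = 1 ∨ Real.sqrt 2 ≤ y := by
  have h2 := one_lt_sqrt_two
  rcases h with ⟨a, b, -, -, rfl⟩ | ⟨a, b, -, -, rfl⟩
  · have hb : (0 : ℝ) < b := pos_of_mul_pos_right hy (by positivity)
    have hb : (1 : ℝ) ≤ b := by exact_mod_cast hb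
    right; nlinarith
  · have hb : (1 : ℤ) ≤ b := by exact_mod_cast hy
    rcases hb.eq_or_lt with rfl | hb
    · left; simp
    · have hb : (2 : ℝ) ≤ b := by exact_mod_cast hb
      right; linarith [sqrt_two_lt_two]

lemma one_le (h : IsColumn x y) (hy : 0 < y) : 1 ≤ y := by
  rcases h.eq_one_or_sqrt_two_le hy with h | h <;> linarith [one_lt_sqrt_two]

lemma pos_cases (h : IsColumn x y) (hx : 0 < x) (hy : 0 < y) :
    (1 ≤ x ∧ Real.sqrt 2 ≤ y) ∨ (Real.sqrt 2 ≤ x ∧ y = 1) := by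
  rcases h.eq_one_or_sqrt_two_le hy with h1 | h1
  · refine Or.inr ⟨?_, h1⟩
    rcases h.swap.eq_one_or_sqrt_two_le hx with h2 | h2
    · exfalso
      subst h1 h2
      have key : ∀ b : ℤ, (1 : ℝ) ≠ Real.sqrt 2 * b := fun b hb => by
        have hsq : (1 : ℝ) = 2 * (b * b) := by
          calc (1 : ℝ) = (Real.sqrt 2 * b) * (Real.sqrt 2 * b) := by rw [← hb]; ring
            _ = 2 * (b * b) := by linear_combination (b * b : ℝ) * sqrt_two_mul_self
        have : (1 : ℤ) = 2 * (b * b) := by exact_mod_cast hsq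
        omega
      rcases h with ⟨a, b, -, -, hb⟩ | ⟨a, b, -, hb, -⟩
      · exact key _ hb
      · exact key _ hb
    · exact h2
  · exact Or.inl ⟨h.swap.one_le hx, h1⟩

end IsColumn

/-- The column `(X, Y)` of height `X * u + Y * w` has error `|Y * e₂ - X * e₁|` strictly smaller
than every non-proportional column of positive and at most the same height. -/
def IsOptimal (u w e₁ e₂ X Y : ℝ) : Prop :=
  ∀ x y : ℝ, IsColumn x y → 0 < x * u + y * w → x * u + y * w ≤ X * u + Y * w →
    x * Y ≠ y * X → |Y * e₂ - X * e₁| < |y * e₂ - x * e₁|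

namespace IsOptimal

variable {u w e₁ e₂ X Y : ℝ}

lemma swap (h : IsOptimal u w e₁ e₂ X Y) : IsOptimal w u e₂ e₁ Y X := by
  intro x y hxy hpos hle hne
  have := h y x hxy.swap (by linarith) (by linarith) (fun h' => hne h'.symm)
  rwa [abs_sub_comm, abs_sub_comm (y * e₁)]

lemma sqrt_two_mul_le (h : IsOptimal u w e₁ e₂ X Y) (hc : IsColumn X Y) (hu : 0 ≤ u) (hw : 0 < w)
    (hX : 0 < X) (hY : 0 < Y) (he₂ : 0 < e₂) (he : Real.sqrt 2 * e₂ < e₁) :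
    Real.sqrt 2 * X ≤ Y := by
  have h1 := one_lt_sqrt_two
  have h2 := sqrt_two_mul_self
  by_contra! hlt
  rcases hc.pos_cases hX hY with ⟨hX1, hY2⟩ | ⟨hX2, rfl⟩
  · have := h 1 (Real.sqrt 2) IsColumn.one_sqrt_two (by nlinarith) (by nlinarith)
      (by rw [one_mul]; exact hlt.ne)
    have hle : Real.sqrt 2 * e₂ - 1 * e₁ < 0 := by linarith
    rw [abs_of_neg hle, abs_lt] at this
    have ha : 0 < (Real.sqrt 2 * X - Y) * e₁ := mul_pos (by linarith) (by nlinarith)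
    have hb : 0 ≤ (Y - Real.sqrt 2) * (e₁ - Real.sqrt 2 * e₂) :=
      mul_nonneg (by linarith) (by linarith)
    nlinarith
  · have := h 0 1 IsColumn.zero_one (by linarith) (by nlinarith) (by linarith)
    have hpos : 0 < 1 * e₂ - 0 * e₁ := by linarith
    rw [abs_of_pos hpos, abs_lt] at this
    have he₁ : 0 < e₁ := (mul_pos (by linarith) he₂).trans he
    have ha : Real.sqrt 2 * e₁ ≤ X * e₁ := mul_le_mul_of_nonneg_right hX2 he₁.le
    have hb : Real.sqrt 2 * (Real.sqrt 2 * e₂) < Real.sqrt 2 * e₁ :=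
      mul_lt_mul_of_pos_left he (by linarith)
    rw [← mul_assoc, h2] at hb
    linarith

lemma le_sqrt_two_mul (h : IsOptimal u w e₁ e₂ X Y) (hc : IsColumn X Y) (hu : 0 ≤ u)
    (hw : 0 ≤ w) (huw : 0 < u + w) (hX : 0 < X) (he₂ : 0 < e₂) (he : e₁ < Real.sqrt 2 * e₂) :
    Y ≤ Real.sqrt 2 * X := by
  have h1 := one_lt_sqrt_two
  have hX1 := hc.swap.one_le hX
  by_contra! hlt
  have hY : Real.sqrt 2 ≤ Y := by nlinarith
  have := h 1 (Real.sqrt 2) IsColumn.one_sqrt_two (by nlinarith) (by nlinarith)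
      (by rw [one_mul]; exact hlt.ne')
  have hpos : 0 < Real.sqrt 2 * e₂ - 1 * e₁ := by linarith
  rw [abs_of_pos hpos, abs_lt] at this
  have ha : 0 < (Y - Real.sqrt 2 * X) * e₂ := mul_pos (by linarith) he₂
  have hb : 0 ≤ (X - 1) * (Real.sqrt 2 * e₂ - e₁) := mul_nonneg (by linarith) (by linarith)
  nlinarith

end IsOptimal

section Expansion

variable (d : ℕ → ℕ) {n : ℕ}

lemma Gmat_succ (n : ℕ) : Gmat d (n + 1) = Gmat d n * Amat (d (n + 1)) := by
  simp [Gmat, List.range_succ]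

variable {d}

lemma expansion_zero : tn d 0 = 1 ∧ vn d 0 = 0 ∧ un d 0 = 0 ∧ wn d 0 = 1 := by
  simp [tn, vn, un, wn, Gmat]

lemma expansion_succ_of_one (h : d (n + 1) = 1) :
    tn d (n + 1) = tn d n + Real.sqrt 2 * vn d n ∧ vn d (n + 1) = vn d n ∧
    un d (n + 1) = un d n + Real.sqrt 2 * wn d n ∧ wn d (n + 1) = wn d n := by
  simp [tn, vn, un, wn, Gmat_succ, h, Amat, Matrix.mul_apply, Fin.sum_univ_two, mul_comm]

lemma expansion_succ_of_two (h : d (n + 1) = 2) :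
    tn d (n + 1) = Real.sqrt 2 * tn d n + vn d n ∧
    vn d (n + 1) = tn d n + Real.sqrt 2 * vn d n ∧
    un d (n + 1) = Real.sqrt 2 * un d n + wn d n ∧
    wn d (n + 1) = un d n + Real.sqrt 2 * wn d n := by
  simp [tn, vn, un, wn, Gmat_succ, h, Amat, Matrix.mul_apply, Fin.sum_univ_two, mul_comm]

lemma expansion_succ_of_three (h : d (n + 1) = 3) :
    tn d (n + 1) = tn d n ∧ vn d (n + 1) = Real.sqrt 2 * tn d n + vn d n ∧
    un d (n + 1) = un d n ∧ wn d (n + 1) = Real.sqrt 2 * un d n + wn d n := by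
  simp [tn, vn, un, wn, Gmat_succ, h, Amat, Matrix.mul_apply, Fin.sum_univ_two, mul_comm]

lemma expansion_det (hd : ∀ n : ℕ, 1 ≤ n → d n = 1 ∨ d n = 2 ∨ d n = 3)
    (n : ℕ) : tn d n * wn d n - un d n * vn d n = 1 := by
  induction n with
  | zero => simp [expansion_zero]
  | succ n ih =>
    rcases hd (n + 1) (by omega) with h | h | h
    · obtain ⟨h1, h2, h3, h4⟩ := expansion_succ_of_one h
      rw [h1, h2, h3, h4]; linear_combination ih
    · obtain ⟨h1, h2, h3, h4⟩ := expansion_succ_of_two h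
      rw [h1, h2, h3, h4]
      linear_combination ih + (tn d n * wn d n - un d n * vn d n) * sqrt_two_mul_self
    · obtain ⟨h1, h2, h3, h4⟩ := expansion_succ_of_three h
      rw [h1, h2, h3, h4]; linear_combination ih

lemma isColumn_expansion (hd : ∀ n : ℕ, 1 ≤ n → d n = 1 ∨ d n = 2 ∨ d n = 3)
    (n : ℕ) {x y : ℝ} (hc : IsColumn x y) :
    IsColumn (x * tn d n + y * vn d n) (x * un d n + y * wn d n) := by
  induction n generalizing x y with
  | zero => simpa [expansion_zero] using hc
  | succ n ih =>
    rcases hd (n + 1) (by omega) with h | h | h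
    · obtain ⟨h1, h2, h3, h4⟩ := expansion_succ_of_one h
      rw [h1, h2, h3, h4]; convert ih hc.add_right using 1 <;> ring
    · obtain ⟨h1, h2, h3, h4⟩ := expansion_succ_of_two h
      rw [h1, h2, h3, h4]; convert ih hc.mix using 1 <;> ring
    · obtain ⟨h1, h2, h3, h4⟩ := expansion_succ_of_three h
      rw [h1, h2, h3, h4]; convert ih hc.add_left using 1 <;> ring

lemma isColumn_expansion_inv (hd : ∀ n : ℕ, 1 ≤ n → d n = 1 ∨ d n = 2 ∨ d n = 3)
    (n : ℕ) {p q : ℝ} (hc : IsColumn p q) :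
    IsColumn (wn d n * p - vn d n * q) (tn d n * q - un d n * p) := by
  induction n with
  | zero => simpa [expansion_zero] using hc
  | succ n ih =>
    rcases hd (n + 1) (by omega) with h | h | h
    · obtain ⟨h1, h2, h3, h4⟩ := expansion_succ_of_one h
      rw [h1, h2, h3, h4]; convert ih.sub_right using 1; ring
    · obtain ⟨h1, h2, h3, h4⟩ := expansion_succ_of_two h
      rw [h1, h2, h3, h4]; convert ih.unmix using 1 <;> ring
    · obtain ⟨h1, h2, h3, h4⟩ := expansion_succ_of_three h
      rw [h1, h2, h3, h4]; convert ih.sub_left using 1; ring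

lemma IsBest.isOptimal {α p q : ℝ} (hbest : IsBest α p q)
    (hd : ∀ n : ℕ, 1 ≤ n → d n = 1 ∨ d n = 2 ∨ d n = 3) (n : ℕ) :
    IsOptimal (un d n) (wn d n) (tn d n - un d n * α) (wn d n * α - vn d n)
      (wn d n * p - vn d n * q) (tn d n * q - un d n * p) := by
  intro x y hc hpos hle hne
  have hdet := expansion_det hd n
  have hq : (wn d n * p - vn d n * q) * un d n + (tn d n * q - un d n * p) * wn d n = q := by
    linear_combination q * hdet
  have hQ : 0 < q := hbest.1.1
  rw [hq] at hle
  have := hbest.2 _ _ ((isColumn_expansion hd n hc).qH4 hpos) (fun he => hne ?_) hle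
  · convert this using 2
    · linear_combination (q * α - p) * hdet
    · ring
  · rw [div_eq_div_iff hpos.ne' hQ.ne'] at he
    linear_combination he

end Expansion

lemma expansion_of_forall_three {d : ℕ → ℕ} {m : ℕ}
    (hm : ∀ n : ℕ, 1 ≤ n → n ≤ m → d n = 3) {n : ℕ} (hn : n ≤ m) :
    tn d n = 1 ∧ un d n = 0 ∧ wn d n = 1 := by
  induction n with
  | zero => simp [expansion_zero]
  | succ n ih =>
    obtain ⟨h1, h2, h3⟩ := ih (by omega)
    simp [expansion_succ_of_three (hm (n + 1) (by omega) hn), h1, h2, h3]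

lemma expansion_bottom_row_growth {d : ℕ → ℕ}
    (hd : ∀ n : ℕ, 1 ≤ n → d n = 1 ∨ d n = 2 ∨ d n = 3) {m : ℕ}
    (hm : ∀ n : ℕ, 1 ≤ n → n ≤ m → d n = 3) (hm1 : d (m + 1) ≠ 3) (k : ℕ) :
    1 ≤ un d (m + 1 + k) ∧ 1 ≤ wn d (m + 1 + k) ∧
      (k : ℝ) ≤ un d (m + 1 + k) + wn d (m + 1 + k) := by
  have hs := one_lt_sqrt_two
  induction k with
  | zero =>
    obtain ⟨-, hu, hw⟩ := expansion_of_forall_three hm le_rfl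
    rcases hd (m + 1) (by omega) with h | h | h
    · obtain ⟨-, -, h3, h4⟩ := expansion_succ_of_one h
      rw [add_zero, h3, h4, hu, hw]
      refine ⟨?_, ?_, ?_⟩ <;> push_cast <;> linarith
    · obtain ⟨-, -, h3, h4⟩ := expansion_succ_of_two h
      rw [add_zero, h3, h4, hu, hw]
      refine ⟨?_, ?_, ?_⟩ <;> push_cast <;> linarith
    · exact absurd h hm1
  | succ k ih =>
    obtain ⟨hu, hw, hk⟩ := ih
    rw [← add_assoc]
    rcases hd (m + 1 + k + 1) (by omega) with h | h | h
    · obtain ⟨-, -, h3, h4⟩ := expansion_succ_of_one h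
      rw [h3, h4]
      refine ⟨?_, ?_, ?_⟩ <;> push_cast <;> nlinarith
    · obtain ⟨-, -, h3, h4⟩ := expansion_succ_of_two h
      rw [h3, h4]
      refine ⟨?_, ?_, ?_⟩ <;> push_cast <;> nlinarith
    · obtain ⟨-, -, h3, h4⟩ := expansion_succ_of_three h
      rw [h3, h4]
      refine ⟨?_, ?_, ?_⟩ <;> push_cast <;> nlinarith

/-- A best approximation in the open cone of level `n` lies in the closed cone of level `n + 1`. -/
lemma IsBest.nonneg_succ {α p q : ℝ} {d : ℕ → ℕ} (hbest : IsBest α p q)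
    (hd : ∀ n : ℕ, 1 ≤ n → d n = 1 ∨ d n = 2 ∨ d n = 3) {n : ℕ}
    (he : ∀ k, 1 ≤ k → vn d k < wn d k * α ∧ un d k * α < tn d k)
    (he₁ : un d n * α < tn d n) (he₂ : vn d n < wn d n * α)
    (hu : 0 ≤ un d n) (hu3 : d (n + 1) = 3 → 0 < un d n) (hw : 0 < wn d n)
    (hX : 0 < wn d n * p - vn d n * q) (hY : 0 < tn d n * q - un d n * p) :
    0 ≤ wn d (n + 1) * p - vn d (n + 1) * q ∧ 0 ≤ tn d (n + 1) * q - un d (n + 1) * p := by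
  have hopt := hbest.isOptimal hd n
  have hc := isColumn_expansion_inv hd n (IsColumn.of_QH4 hbest.1)
  obtain ⟨hv', ht'⟩ := he (n + 1) (by omega)
  rw [← sub_pos] at he₁ he₂
  rcases hd (n + 1) (by omega) with h | h | h
  · obtain ⟨h1, h2, h3, h4⟩ := expansion_succ_of_one h
    rw [h1, h3] at ht'
    rw [h1, h2, h3, h4]
    have := hopt.sqrt_two_mul_le hc hu hw hX hY he₂ (by linarith)
    constructor <;> linarith
  · obtain ⟨h1, h2, h3, h4⟩ := expansion_succ_of_two h
    rw [h1, h3] at ht'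
    rw [h2, h4] at hv'
    rw [h1, h2, h3, h4]
    have hYX := hopt.le_sqrt_two_mul hc hu hw.le (by linarith) hX he₂ (by linarith)
    have hXY := hopt.swap.le_sqrt_two_mul hc.swap hw.le hu (by linarith) hY he₁ (by linarith)
    constructor <;> linarith
  · obtain ⟨h1, h2, h3, h4⟩ := expansion_succ_of_three h
    rw [h2, h4] at hv'
    rw [h1, h2, h3, h4]
    have := hopt.swap.sqrt_two_mul_le hc.swap hw.le (hu3 h) hY hX he₁ (by linarith)
    constructor <;> linarith

/-- A best approximation lies in the closed cone of the first level after the leading threes. -/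
lemma IsBest.nonneg_first {α p q : ℝ} {d : ℕ → ℕ} (hbest : IsBest α p q) (hα : 0 < α)
    (hd : ∀ n : ℕ, 1 ≤ n → d n = 1 ∨ d n = 2 ∨ d n = 3)
    (he : ∀ k, 1 ≤ k → vn d k < wn d k * α ∧ un d k * α < tn d k)
    {m : ℕ} (hm : ∀ n : ℕ, 1 ≤ n → n ≤ m → d n = 3) (hm1 : d (m + 1) ≠ 3) :
    0 ≤ wn d (m + 1) * p - vn d (m + 1) * q ∧ 0 ≤ tn d (m + 1) * q - un d (m + 1) * p := by
  have hs := one_lt_sqrt_two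
  obtain ⟨ht, hu, hw⟩ := expansion_of_forall_three hm le_rfl
  have hq := hbest.1.1
  have he₁ : un d m * α < tn d m := by rw [ht, hu]; linarith
  have he₂ : vn d m < wn d m * α := by
    rcases m.eq_zero_or_pos with rfl | hpos
    · simpa [expansion_zero] using hα
    · exact (he m hpos).1
  obtain ⟨hv', ht'⟩ := he (m + 1) (by omega)
  rcases lt_or_ge 0 (wn d m * p - vn d m * q) with hX | hX
  · exact hbest.nonneg_succ hd he he₁ he₂ hu.ge (fun h => absurd h hm1) (by rw [hw]; norm_num)
      hX (by rw [ht, hu]; linarith)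
  have hopt := hbest.isOptimal hd m
  have hq1 := (IsColumn.of_QH4 hbest.1).one_le hq
  rw [ht, hu, hw] at hopt
  rw [hw] at he₂ hX
  simp only [one_mul, zero_mul, sub_zero] at hopt he₂ hX
  have herr : q * (α - vn d m) ≤ |q * (α - vn d m) - (p - vn d m * q) * 1| :=
    le_trans (by linarith) (le_abs_self _)
  have hge : α - vn d m ≤ q * (α - vn d m) := by nlinarith
  rcases hd (m + 1) (by omega) with h | h | h
  · obtain ⟨h1, h2, h3, h4⟩ := expansion_succ_of_one h
    rw [h1, h2, h3, h4, ht, hu, hw]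
    rcases hX.lt_or_eq with hX0 | hX0
    · exfalso
      have := hopt 0 1 IsColumn.zero_one (by norm_num) (by linarith) (by linarith)
      rw [abs_of_pos (a := 1 * (α - vn d m) - 0 * 1) (by linarith)] at this
      linarith
    · constructor <;> nlinarith
  · exfalso
    obtain ⟨h1, h2, h3, h4⟩ := expansion_succ_of_two h
    rw [h2, h4, ht, hu, hw] at hv'
    rw [h1, h3, ht, hu, hw] at ht'
    have hs2 := sqrt_two_mul_self
    have := hopt (Real.sqrt 2) 1 IsColumn.one_sqrt_two.swap (by norm_num) (by linarith)
      (by have := mul_pos (zero_lt_one.trans hs) hq; linarith)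
    rw [abs_sub_comm (1 * (α - vn d m)),
      abs_of_pos (a := Real.sqrt 2 * 1 - 1 * (α - vn d m)) (by linarith)] at this
    nlinarith
  · exact absurd h hm1

theorem best_approx_is_convergent (α : ℝ) (hα : 0 < α) (hirr : NotSqrt2Rat α)
    (d : ℕ → ℕ)
    (hd : ∀ n : ℕ, 1 ≤ n → d n = 1 ∨ d n = 2 ∨ d n = 3)
    (hmem : ∀ n : ℕ, 1 ≤ n → vn d n < wn d n * α ∧ un d n * α < tn d n)
    (m : ℕ) (hm : ∀ n : ℕ, 1 ≤ n → n ≤ m → d n = 3) (hm1 : d (m + 1) ≠ 3)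
    (p q : ℝ) (hbest : IsBest α p q) :
    ∃ n : ℕ, m + 1 ≤ n ∧ (p / q = tn d n / un d n ∨ p / q = vn d n / wn d n) := by
  have hQ := hbest.1
  have hq := hQ.1
  by_contra! hno
  have hpos : ∀ k : ℕ, 0 ≤ wn d (m + 1 + k) * p - vn d (m + 1 + k) * q →
      0 ≤ tn d (m + 1 + k) * q - un d (m + 1 + k) * p →
      0 < wn d (m + 1 + k) * p - vn d (m + 1 + k) * q ∧
      0 < tn d (m + 1 + k) * q - un d (m + 1 + k) * p := by
    intro k hX hY
    obtain ⟨hu, hw, -⟩ := expansion_bottom_row_growth hd hm hm1 k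
    obtain ⟨hn1, hn2⟩ := hno (m + 1 + k) (by omega)
    refine ⟨hX.lt_of_ne fun h => hn2 ?_, hY.lt_of_ne fun h => hn1 ?_⟩
    · rw [div_eq_div_iff hq.ne' (by positivity)]; linarith
    · rw [div_eq_div_iff hq.ne' (by positivity)]; linarith
  have hcone : ∀ k : ℕ, 0 < wn d (m + 1 + k) * p - vn d (m + 1 + k) * q ∧
      0 < tn d (m + 1 + k) * q - un d (m + 1 + k) * p := by
    intro k
    induction k with
    | zero =>
      obtain ⟨hX, hY⟩ := hbest.nonneg_first hα hd hmem hm hm1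
      exact hpos 0 hX hY
    | succ k ih =>
      obtain ⟨hu, hw, -⟩ := expansion_bottom_row_growth hd hm hm1 k
      obtain ⟨he₂, he₁⟩ := hmem (m + 1 + k) (by omega)
      obtain ⟨hX, hY⟩ := hbest.nonneg_succ hd hmem he₁ he₂ (by linarith) (fun _ => by linarith)
        (by linarith) ih.1 ih.2
      exact hpos (k + 1) hX hY
  obtain ⟨k, hk⟩ := exists_nat_gt q
  obtain ⟨hX, hY⟩ := hcone k
  obtain ⟨hu, hw, hgrow⟩ := expansion_bottom_row_growth hd hm hm1 k
  have hc := isColumn_expansion_inv hd (m + 1 + k) (IsColumn.of_QH4 hQ)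
  have hX1 := hc.swap.one_le hX
  have hY1 := hc.one_le hY
  have hheight : (wn d (m + 1 + k) * p - vn d (m + 1 + k) * q) * un d (m + 1 + k) +
      (tn d (m + 1 + k) * q - un d (m + 1 + k) * p) * wn d (m + 1 + k) = q := by
    linear_combination q * expansion_det hd (m + 1 + k)
  nlinarith
end

section
/- Let α > 0 be a real number with α ∉ √2·ℚ. If p/q and p'/q' are consecutive H₄-best approximations of α, then 1/2 < q'·|q·α − p| < (√2 + 1)/2. -/
/-- p/q and p'/q' are consecutive H₄-best approximations of α. -/
def Consecutive (α p q p' q' : ℝ) : Prop :=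
  IsBest α p q ∧ IsBest α p' q' ∧ q < q' ∧
    ∀ r s : ℝ, IsBest α r s → ¬ (q < s ∧ s < q')

/-- `(p, q)` is the first column of a matrix of the Hecke group H₄. -/
def IsCol (p q : ℝ) : Prop := ∃ r s : ℝ, H4form p r q s

lemma sqrt_two_gt : (1.41 : ℝ) < Real.sqrt 2 := Real.lt_sqrt_of_sq_lt (by norm_num)

lemma sqrt_two_lt : Real.sqrt 2 < (1.42 : ℝ) := by
  rw [Real.sqrt_lt' (by norm_num)]
  norm_num

lemma eq_zero_of_sqrt_two_mul_eq {m n : ℤ} (h : Real.sqrt 2 * n = m) : n = 0 := by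
  by_contra hn
  have hn' : (n : ℝ) ≠ 0 := by exact_mod_cast hn
  refine irrational_sqrt_two ⟨(m : ℚ) / n, ?_⟩
  push_cast
  rw [← h]
  field_simp

lemma H4form.of_det_left {a b c d : ℤ} (h : a * d - 2 * b * c = 1) :
    H4form a (Real.sqrt 2 * b) (Real.sqrt 2 * c) d := by
  have hodd : Odd (a * d) := ⟨b * c, by linarith⟩
  rw [Int.odd_mul] at hodd
  exact Or.inl ⟨a, b, c, d, hodd.1, hodd.2, h, rfl, rfl, rfl, rfl⟩

lemma H4form.of_det_right {a b c d : ℤ} (h : 2 * a * d - b * c = 1) :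
    H4form (Real.sqrt 2 * a) b c (Real.sqrt 2 * d) := by
  have hodd : Odd (b * c) := ⟨a * d - 1, by linarith⟩
  rw [Int.odd_mul] at hodd
  exact Or.inr ⟨a, b, c, d, hodd.1, hodd.2, h, rfl, rfl, rfl, rfl⟩

lemma IsCol.of_det_left {a c : ℤ} (b d : ℤ) (h : a * d - 2 * b * c = 1) :
    IsCol a (Real.sqrt 2 * c) :=
  ⟨_, _, H4form.of_det_left h⟩

lemma IsCol.of_det_right {a c : ℤ} (b d : ℤ) (h : 2 * a * d - b * c = 1) :
    IsCol (Real.sqrt 2 * a) c :=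
  ⟨_, _, H4form.of_det_right h⟩

lemma IsCol.cases {p q : ℝ} (h : IsCol p q) :
    (∃ a b c d : ℤ, a * d - 2 * b * c = 1 ∧ p = a ∧ q = Real.sqrt 2 * c) ∨
    (∃ a b c d : ℤ, 2 * a * d - b * c = 1 ∧ p = Real.sqrt 2 * a ∧ q = c) := by
  obtain ⟨r, s, ⟨a, b, c, d, -, -, h, hp, -, hq, -⟩ | ⟨a, b, c, d, -, -, h, hp, -, hq, -⟩⟩ := h
  · exact Or.inl ⟨a, b, c, d, h, hp, hq⟩
  · exact Or.inr ⟨a, b, c, d, h, hp, hq⟩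

lemma H4form.det_eq_one {p r q s : ℝ} (h : H4form p r q s) : p * s - r * q = 1 := by
  have h2 := sqrt_two_mul_self
  obtain ⟨a, b, c, d, -, -, h, rfl, rfl, rfl, rfl⟩ | ⟨a, b, c, d, -, -, h, rfl, rfl, rfl, rfl⟩ := h
  · have h' : (a : ℝ) * d - 2 * b * c = 1 := by exact_mod_cast h
    linear_combination h' - b * c * h2
  · have h' : 2 * (a : ℝ) * d - b * c = 1 := by exact_mod_cast h
    linear_combination h' + a * d * h2

lemma H4form.inv {p r q s : ℝ} (h : H4form p r q s) : H4form s (-r) (-q) p := by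
  obtain ⟨a, b, c, d, -, -, h, rfl, rfl, rfl, rfl⟩ | ⟨a, b, c, d, -, -, h, rfl, rfl, rfl, rfl⟩ := h
  · have := H4form.of_det_left (a := d) (b := -b) (c := -c) (d := a) (by linarith)
    simpa using this
  · have := H4form.of_det_right (a := d) (b := -b) (c := -c) (d := a) (by linarith)
    simpa using this

lemma H4form.mul_col {p r q s x y : ℝ} (h : H4form p r q s) (hxy : IsCol x y) :
    IsCol (p * x + r * y) (q * x + s * y) := by
  have h2 := sqrt_two_mul_self
  obtain ⟨a, b, c, d, -, -, h, rfl, rfl, rfl, rfl⟩ | ⟨a, b, c, d, -, -, h, rfl, rfl, rfl, rfl⟩ := h <;>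
  obtain ⟨e, f, g, k, h', rfl, rfl⟩ | ⟨e, f, g, k, h', rfl, rfl⟩ := hxy.cases
  · have := IsCol.of_det_left (a := a * e + 2 * b * g) (c := c * e + d * g)
      (a * f + b * k) (2 * c * f + d * k)
      (by linear_combination (a * d - 2 * b * c) * h' + h)
    convert this using 1 <;> push_cast
    · linear_combination b * g * h2
    · ring
  · have := IsCol.of_det_right (a := a * e + b * g) (c := 2 * c * e + d * g)
      (a * f + 2 * b * k) (c * f + d * k)
      (by linear_combination (a * d - 2 * b * c) * h' + h)
    convert this using 1 <;> push_cast
    · ring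
    · linear_combination c * e * h2
  · have := IsCol.of_det_right (a := a * e + b * g) (c := c * e + 2 * d * g)
      (2 * a * f + b * k) (c * f + d * k)
      (by linear_combination (2 * a * d - b * c) * h' + h)
    convert this using 1 <;> push_cast
    · ring
    · linear_combination d * g * h2
  · have := IsCol.of_det_left (a := 2 * a * e + b * g) (c := c * e + d * g)
      (a * f + b * k) (c * f + 2 * d * k)
      (by linear_combination (2 * a * d - b * c) * h' + h)
    convert this using 1 <;> push_cast
    · linear_combination a * e * h2
    · ring

lemma IsCol.neg {p q : ℝ} (h : IsCol p q) : IsCol (-p) (-q) := by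
  have := (H4form.of_det_left (a := -1) (b := 0) (c := 0) (d := -1) (by norm_num)).mul_col h
  simpa using this

lemma qH4_iff {p q : ℝ} : QH4 p q ↔ 0 < q ∧ IsCol p q := by
  refine and_congr_right fun _ => ⟨?_, ?_⟩
  · rintro ⟨r, s, h | h⟩
    · exact ⟨r, s, h⟩
    · simpa using IsCol.neg ⟨_, _, h⟩
  · rintro ⟨r, s, h⟩
    exact ⟨r, s, Or.inl h⟩

lemma IsCol.left_of_right_zero {x y : ℝ} (h : IsCol x y) (hy : y = 0) : x = 1 ∨ x = -1 := by
  obtain ⟨a, b, c, d, h, rfl, hq⟩ | ⟨a, b, c, d, h, rfl, hq⟩ := h.cases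
  · have hc : c = 0 := by
      have : (c : ℝ) = 0 := by simpa [hq] using hy
      exact_mod_cast this
    subst hc
    have : a * d = 1 := by linarith
    rcases Int.eq_one_or_neg_one_of_mul_eq_one this with rfl | rfl <;> simp
  · have hc : c = 0 := by
      rw [hq] at hy
      exact_mod_cast hy
    subst hc
    have : 2 * (a * d) = 1 := by linarith
    omega

lemma IsCol.one_le_of_pos {p q : ℝ} (h : IsCol p q) (hq : 0 < q) : 1 ≤ q := by
  have h2 := sqrt_two_gt
  obtain ⟨a, b, c, d, h, rfl, rfl⟩ | ⟨a, b, c, d, h, rfl, rfl⟩ := h.cases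
  · have hc : (0 : ℝ) < c := by
      by_contra! hc
      nlinarith
    have : (1 : ℝ) ≤ c := by exact_mod_cast (by exact_mod_cast hc : (0 : ℤ) < c)
    nlinarith
  · exact_mod_cast (by exact_mod_cast hq : (0 : ℤ) < c)

lemma IsCol.sq_eq_natCast {p q : ℝ} (h : IsCol p q) : ∃ n : ℕ, q ^ 2 = n := by
  obtain ⟨a, b, c, d, h, rfl, rfl⟩ | ⟨a, b, c, d, h, rfl, rfl⟩ := h.cases
  · refine ⟨2 * c.natAbs ^ 2, ?_⟩
    push_cast
    rw [Nat.cast_natAbs, Int.cast_abs, sq_abs]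
    linear_combination (c : ℝ) ^ 2 * sqrt_two_mul_self
  · refine ⟨c.natAbs ^ 2, ?_⟩
    push_cast
    rw [Nat.cast_natAbs, Int.cast_abs, sq_abs]

/-- Columns with the same nonzero lower entry have well separated upper entries. -/
lemma IsCol.sqrt_two_le_abs_sub {p r q : ℝ} (h : IsCol p q) (h' : IsCol r q) (hpr : p ≠ r)
    (hq : q ≠ 0) : Real.sqrt 2 ≤ |p - r| := by
  obtain ⟨a, b, c, d, h, rfl, rfl⟩ | ⟨a, b, c, d, h, rfl, rfl⟩ := h.cases <;>
  obtain ⟨e, f, g, k, h', rfl, hg⟩ | ⟨e, f, g, k, h', rfl, hg⟩ := h'.cases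
  · have hae : a ≠ e := by exact_mod_cast hpr
    have ha : Odd (a * d) := ⟨b * c, by linarith⟩
    have he : Odd (e * k) := ⟨f * g, by linarith⟩
    rw [Int.odd_mul] at ha he
    obtain ⟨u, hu⟩ := ha.1
    obtain ⟨v, hv⟩ := he.1
    have : 2 ≤ |a - e| := by
      rw [le_abs]
      omega
    have : (2 : ℝ) ≤ |(a : ℝ) - e| := by exact_mod_cast this
    linarith [sqrt_two_lt]
  · exact absurd (by simp [eq_zero_of_sqrt_two_mul_eq hg]) hq
  · exact absurd (by rw [hg, eq_zero_of_sqrt_two_mul_eq hg.symm]; simp) hq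
  · have hae : a ≠ e := by
      rintro rfl
      exact hpr rfl
    have : 1 ≤ |a - e| := Int.one_le_abs (sub_ne_zero.2 hae)
    have : (1 : ℝ) ≤ |(a : ℝ) - e| := by exact_mod_cast this
    rw [← mul_sub, abs_mul, abs_of_pos (by linarith [sqrt_two_gt])]
    nlinarith [sqrt_two_gt]

lemma IsCol.ne_sqrt_two_sub_one_mul {p q p' q' : ℝ} (h : IsCol p q) (h' : IsCol p' q')
    (hq' : q' ≠ 0) : q ≠ (Real.sqrt 2 - 1) * q' := by
  intro H
  have h2 := sqrt_two_mul_self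
  obtain ⟨a, b, c, d, h, rfl, rfl⟩ | ⟨a, b, c, d, h, rfl, rfl⟩ := h.cases <;>
  obtain ⟨e, f, g, k, h', rfl, rfl⟩ | ⟨e, f, g, k, h', rfl, rfl⟩ := h'.cases
  · have := eq_zero_of_sqrt_two_mul_eq (n := g) (m := c + g) (by
      push_cast
      refine mul_left_cancel₀ (show Real.sqrt 2 ≠ 0 by linarith [sqrt_two_gt]) ?_
      linear_combination -H)
    exact hq' (by simp [this])
  · have hg : Real.sqrt 2 * (g - c : ℤ) = g := by
      push_cast
      linear_combination -H
    rw [eq_zero_of_sqrt_two_mul_eq hg] at hg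
    exact hq' (by simpa using hg.symm)
  · have := eq_zero_of_sqrt_two_mul_eq (n := g) (m := 2 * g - c) (by
      push_cast
      linear_combination H + g * h2)
    exact hq' (by simp [this])
  · have := eq_zero_of_sqrt_two_mul_eq (n := g) (m := c + g) (by
      push_cast
      linear_combination -H)
    exact hq' (by simp [this])

lemma IsBest.abs_le {α p q r s : ℝ} (h : IsBest α p q) (hrs : IsCol r s) (hs : 0 < s)
    (hsq : s ≤ q) : |q * α - p| ≤ |s * α - r| := by
  by_cases hne : r / s = p / q
  · obtain ⟨hq, u, v, hM⟩ := qH4_iff.1 h.1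
    have hcol := hM.inv.mul_col hrs
    rw [div_eq_div_iff hs.ne' hq.ne'] at hne
    have hdet := hM.det_eq_one
    have hr : r = p * (v * r + -u * s) := by
      linear_combination (-r) * hdet - u * hne
    have hs' : s = q * (v * r + -u * s) := by
      linear_combination (-s) * hdet - v * hne
    rcases hcol.left_of_right_zero (by linear_combination -hne) with h1 | h1 <;> rw [h1] at hr hs'
    · rw [hr, hs']; simp
    · linarith
  · exact (h.2 r s (qH4_iff.2 ⟨hs, hrs⟩) hne hsq).le

lemma IsBest.abs_le_sqrt_two_div {α p q : ℝ} (h : IsBest α p q) :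
    |q * α - p| ≤ Real.sqrt 2 / 2 := by
  have h2 : (0 : ℝ) < Real.sqrt 2 := by positivity
  obtain ⟨hq, hcol⟩ := qH4_iff.1 h.1
  have h1 := h.abs_le (IsCol.of_det_right (a := round (α / Real.sqrt 2)) (c := 1) (-1) 0 (by norm_num))
    (by norm_num) (by simpa using hcol.one_le_of_pos hq)
  refine h1.trans ?_
  have h3 := abs_sub_round (α / Real.sqrt 2)
  have h4 : ((1 : ℤ) : ℝ) * α - Real.sqrt 2 * round (α / Real.sqrt 2) =
      Real.sqrt 2 * (α / Real.sqrt 2 - round (α / Real.sqrt 2)) := by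
    field_simp
    simp
  rw [h4, abs_mul, abs_of_pos h2]
  nlinarith

/-- Between two consecutive best approximations there is no column with a smaller error. -/
lemma Consecutive.abs_le {α p q p' q' : ℝ} (h : Consecutive α p q p' q') {r s : ℝ}
    (hrs : IsCol r s) (hs : |s| < q') : |q * α - p| ≤ |s * α - r| := by
  obtain ⟨hb, -, -, hbetween⟩ := h
  have hL := hb.abs_le_sqrt_two_div
  have key : ∀ n : ℕ, ∀ r s : ℝ, IsCol r s → 0 < s → s < q' → s ^ 2 = n →
      |q * α - p| ≤ |s * α - r| := by
    intro n
    induction n using Nat.strong_induction_on with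
    | _ n ih =>
      intro r s hrs hs hsq' hn
      by_contra! hlt
      have hqs : q < s := by
        by_contra! hle
        exact absurd (hb.abs_le hrs hs hle) (not_le.2 hlt)
      refine hbetween r s ⟨qH4_iff.2 ⟨hs, hrs⟩, fun r₁ s₁ h₁ hne hle => ?_⟩ ⟨hqs, hsq'⟩
      obtain ⟨hs₁, hcol₁⟩ := qH4_iff.1 h₁
      refine hlt.trans_le ?_
      rcases hle.lt_or_eq with hlt' | rfl
      · obtain ⟨m, hm⟩ := hcol₁.sq_eq_natCast
        refine ih m ?_ r₁ s₁ hcol₁ hs₁ (hlt'.trans hsq') hm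
        have : (m : ℝ) < n := by
          rw [← hm, ← hn]
          gcongr
        exact_mod_cast this
      · have hr : r₁ ≠ r := by
          rintro rfl
          exact hne rfl
        have := hcol₁.sqrt_two_le_abs_sub hrs hr hs.ne'
        have htri : |r₁ - r| ≤ |s₁ * α - r₁| + |s₁ * α - r| := by
          rw [abs_sub_comm r₁ r]
          calc |r - r₁| = |(s₁ * α - r₁) - (s₁ * α - r)| := by ring_nf
            _ ≤ _ := abs_sub _ _
        linarith
  rcases lt_trichotomy s 0 with hneg | rfl | hpos
  · obtain ⟨n, hn⟩ := hrs.neg.sq_eq_natCast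
    have := key n (-r) (-s) hrs.neg (by linarith) (by rwa [abs_of_neg hneg] at hs) hn
    rwa [show -s * α - -r = -(s * α - r) by ring, abs_neg] at this
  · have : |q * α - p| ≤ 1 := by linarith [sqrt_two_lt]
    rcases hrs.left_of_right_zero rfl with rfl | rfl <;> simpa using this
  · obtain ⟨n, hn⟩ := hrs.sq_eq_natCast
    exact key n r s hrs hpos (by rwa [abs_of_pos hpos] at hs) hn

lemma bound_of_det_one {q q' l l' : ℝ} (hq : 0 < q) (hqq' : q < q') (hl : |l'| < |l|)
    (hdet : |q' * l - q * l'| = 1) (h₁ : |q' - Real.sqrt 2 * q| < q' → |l| ≤ |l' - Real.sqrt 2 * l|)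
    (h₂ : |Real.sqrt 2 * q' - q| < q' → |l| ≤ |Real.sqrt 2 * l' - l|)
    (hne : q ≠ (Real.sqrt 2 - 1) * q') : q' * |l| < (Real.sqrt 2 + 1) / 2 := by
  wlog hpos : 0 ≤ l generalizing l l'
  · have := this (l := -l) (l' := -l') (by simpa using hl)
      (by rw [← hdet, ← abs_neg]; ring_nf)
      (fun h => by
        rw [abs_neg, show -l' - Real.sqrt 2 * -l = -(l' - Real.sqrt 2 * l) by ring, abs_neg]
        exact h₁ h)
      (fun h => by
        rw [abs_neg, show Real.sqrt 2 * -l' - -l = -(Real.sqrt 2 * l' - l) by ring, abs_neg]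
        exact h₂ h) (by linarith)
    simpa using this
  have hs := sqrt_two_mul_self
  have hlo := sqrt_two_gt
  have hhi := sqrt_two_lt
  rw [abs_of_nonneg hpos] at *
  obtain ⟨hl1, hl2⟩ := abs_lt.1 hl
  have hlpos : 0 < l := by linarith
  have hdet' : q' * l - q * l' = 1 := by
    rw [abs_of_nonneg] at hdet
    · exact hdet
    · nlinarith
  by_cases hl' : l' ≤ 0
  · nlinarith
  push Not at hl'
  have hl3 : l' ≤ (Real.sqrt 2 - 1) * l := by
    have := h₁ (by rw [abs_lt]; constructor <;> nlinarith)
    rw [abs_of_neg (by nlinarith)] at this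
    linarith
  have hq3 : q < (Real.sqrt 2 - 1) * q' := by
    refine lt_of_le_of_ne ?_ hne
    by_contra! hgt
    have := h₂ (by rw [abs_lt]; constructor <;> nlinarith)
    rcases le_abs.1 this with h | h <;> nlinarith
  have h3 : q * l' < ((Real.sqrt 2 - 1) * q') * ((Real.sqrt 2 - 1) * l) := by
    calc q * l' < ((Real.sqrt 2 - 1) * q') * l' := by gcongr
      _ ≤ _ := by
        have : 0 ≤ (Real.sqrt 2 - 1) * q' := by nlinarith
        gcongr
  have h4 : (2 * Real.sqrt 2 - 2) * (q' * l) < 1 := by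
    have e : ((Real.sqrt 2 - 1) * q') * ((Real.sqrt 2 - 1) * l) =
      (3 - 2 * Real.sqrt 2) * (q' * l) := by linear_combination q' * l * hs
    linarith
  nlinarith

lemma bound_of_det_sqrt_two {q q' l l' : ℝ} (hq : 0 < q) (hqq' : q < q') (hl : |l'| < |l|)
    (hdet : |q' * l - q * l'| = Real.sqrt 2)
    (h₁ : |(q' - q) / Real.sqrt 2| < q' → |l| ≤ |(l' - l) / Real.sqrt 2|)
    (h₂ : |(q' + q) / Real.sqrt 2| < q' → |l| ≤ |(l' + l) / Real.sqrt 2|)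
    (hne : q ≠ (Real.sqrt 2 - 1) * q') : q' * |l| < (Real.sqrt 2 + 1) / 2 := by
  wlog hpos : 0 ≤ l generalizing l l'
  · have := this (l := -l) (l' := -l') (by simpa using hl)
      (by rw [← hdet, ← abs_neg]; ring_nf)
      (fun h => by
        rw [abs_neg, show (-l' - -l) / Real.sqrt 2 = -((l' - l) / Real.sqrt 2) by ring, abs_neg]
        exact h₁ h)
      (fun h => by
        rw [abs_neg, show (-l' + -l) / Real.sqrt 2 = -((l' + l) / Real.sqrt 2) by ring, abs_neg]
        exact h₂ h) (by linarith)
    simpa using this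
  have hs := sqrt_two_mul_self
  have hlo := sqrt_two_gt
  have hhi := sqrt_two_lt
  have hspos : 0 < Real.sqrt 2 := by linarith
  simp only [abs_div, abs_of_pos hspos, div_lt_iff₀ hspos, le_div_iff₀ hspos] at h₁ h₂
  rw [abs_of_nonneg hpos] at *
  obtain ⟨hl1, hl2⟩ := abs_lt.1 hl
  have hlpos : 0 < l := by linarith
  have hdet' : q' * l - q * l' = Real.sqrt 2 := by
    rw [abs_of_nonneg] at hdet
    · exact hdet
    · nlinarith
  have hl3 : (Real.sqrt 2 - 1) * l ≤ -l' := by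
    have := h₁ (by rw [abs_lt]; constructor <;> nlinarith)
    rw [abs_of_neg (by linarith)] at this
    linarith
  have hq3 : (Real.sqrt 2 - 1) * q' < q := by
    refine lt_of_le_of_ne ?_ hne.symm
    by_contra! hgt
    have := h₂ (by rw [abs_lt]; constructor <;> nlinarith)
    rw [abs_of_pos (by linarith)] at this
    nlinarith
  have h3 : ((Real.sqrt 2 - 1) * q') * ((Real.sqrt 2 - 1) * l) < q * (-l') := by
    have : 0 < (Real.sqrt 2 - 1) * l := mul_pos (by linarith) hlpos
    calc ((Real.sqrt 2 - 1) * q') * ((Real.sqrt 2 - 1) * l)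
        < q * ((Real.sqrt 2 - 1) * l) := by gcongr
      _ ≤ _ := by gcongr
  have h4 : (4 - 2 * Real.sqrt 2) * (q' * l) < Real.sqrt 2 := by
    have e : ((Real.sqrt 2 - 1) * q') * ((Real.sqrt 2 - 1) * l) =
      (3 - 2 * Real.sqrt 2) * (q' * l) := by linear_combination q' * l * hs
    linarith
  nlinarith

lemma Int.exists_two_mul_abs_sub_mul_le (a : ℤ) {m : ℤ} (hm : m ≠ 0) :
    ∃ k : ℤ, 2 * |a - k * m| ≤ |m| := by
  refine ⟨round ((a : ℚ) / m), ?_⟩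
  have h := abs_sub_round ((a : ℚ) / m)
  have hm' : (m : ℚ) ≠ 0 := by exact_mod_cast hm
  have hpos : (0 : ℚ) < |(m : ℚ)| := abs_pos.2 hm'
  have : (2 : ℚ) * |(a : ℚ) - round ((a : ℚ) / m) * m| ≤ |(m : ℚ)| := by
    have e : (a : ℚ) - round ((a : ℚ) / m) * m = (a / m - round ((a : ℚ) / m)) * m := by
      field_simp
    rw [e, abs_mul]
    nlinarith
  exact_mod_cast this

lemma abs_lt_of_mul_eq_sub {y t z u v B : ℝ} (h : y * z = u - t * v) (hu : |u| ≤ B) (hv : |v| ≤ B)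
    (hB : 0 < B) (hy : 1 + |t| < |y|) : |z| < B := by
  have h₁ : |y| * |z| ≤ |u| + |t| * |v| := by
    rw [← abs_mul, h, ← abs_mul]
    exact abs_sub _ _
  have h₂ : |t| * |v| ≤ |t| * B := by gcongr
  have h₃ : (1 + |t|) * B < |y| * B := by gcongr
  exact lt_of_mul_lt_mul_left (by linarith) (abs_nonneg y)

/-- The upper bound, in coordinates with respect to a basis `(q, l)`, `(s, m)` of determinant `1`
in which the next best approximation is the column `(x, y)`. -/
lemma bound_of_empty_box {q s l m x y : ℝ} (hdet : q * m - s * l = 1) (hxy : IsCol x y)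
    (hq : 0 < q) (hqq' : q < x * q + y * s) (hl : |x * l + y * m| < |l|)
    (hbox : ∀ x₁ y₁ : ℝ, IsCol x₁ y₁ → |x₁ * q + y₁ * s| < x * q + y * s →
      |l| ≤ |x₁ * l + y₁ * m|)
    (hne : q ≠ (Real.sqrt 2 - 1) * (x * q + y * s)) :
    (x * q + y * s) * |l| < (Real.sqrt 2 + 1) / 2 := by
  have hs := sqrt_two_mul_self
  have hlo := sqrt_two_gt
  have hspos : 0 < Real.sqrt 2 := by linarith
  have hlpos : 0 < |l| := (abs_nonneg _).trans_lt hl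
  have hdet' : (x * q + y * s) * l - q * (x * l + y * m) = -y := by
    linear_combination -y * hdet
  have hsmall : ∀ t k : ℝ, IsCol k 1 → x - y * k = t → ¬ 1 + |t| < |y| := by
    intro t k hk ht hy
    refine absurd (hbox k 1 hk ?_) (not_le.2 ?_)
    · exact abs_lt_of_mul_eq_sub (u := x * q + y * s) (v := q) (t := t) (y := y)
        (by rw [← ht]; ring) (abs_of_pos (hq.trans hqq')).le ((abs_of_pos hq).trans_le hqq'.le)
        (hq.trans hqq') hy
    · exact abs_lt_of_mul_eq_sub (u := x * l + y * m) (v := l) (t := t) (y := y)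
        (by rw [← ht]; ring) hl.le le_rfl hlpos hy
  have hshift : ∀ k : ℤ, IsCol (Real.sqrt 2 * k) 1 := fun k => by
    simpa using IsCol.of_det_right (a := k) (c := 1) (-1) 0 (by norm_num)
  obtain ⟨X, b, Y, d, h, rfl, rfl⟩ | ⟨X, b, Y, d, h, rfl, rfl⟩ := hxy.cases
  · have hY : Y ≠ 0 := by
      rintro rfl
      rcases hxy.left_of_right_zero (by simp) with h | h <;> rw [h] at hqq' <;> simp at hqq'
      linarith
    have hX : Odd (X * d) := ⟨b * Y, by linarith⟩
    rw [Int.odd_mul] at hX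
    obtain ⟨e, rfl⟩ := hX.1
    obtain ⟨k, hk⟩ := Int.exists_two_mul_abs_sub_mul_le (2 * e + 1) (m := 2 * Y) (by omega)
    rw [abs_mul, abs_two] at hk
    have hY1 : |Y| = 1 := by
      by_contra hY1
      refine hsmall (2 * e + 1 - k * (2 * Y) : ℤ) _ (hshift k) ?_ ?_
      · push_cast
        linear_combination -Y * k * hs
      · rw [abs_mul, abs_of_pos hspos]
        have hY2 : 2 ≤ |Y| := by
          have := Int.one_le_abs hY
          omega
        have hlt : |2 * e + 1 - k * (2 * Y)| ≤ |Y| := by linarith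
        have hcases : (|Y| = 2 ∧ |2 * e + 1 - k * (2 * Y)| ≤ 1) ∨ 3 ≤ |Y| := by
          rcases hY2.eq_or_lt with h2 | h2
          · refine Or.inl ⟨h2.symm, ?_⟩
            have hne2 : |2 * e + 1 - k * (2 * Y)| ≠ 2 := by
              have e1 : k * (2 * Y) = 2 * (k * Y) := by ring
              rw [e1, Ne, abs_eq (by norm_num)]
              omega
            omega
          · exact Or.inr h2
        rw [← Int.cast_abs, ← Int.cast_abs]
        rcases hcases with ⟨h3, h4⟩ | h3
        · rw [h3]
          have : ((|2 * e + 1 - k * (2 * Y)| : ℤ) : ℝ) ≤ 1 := by exact_mod_cast h4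
          push_cast at *
          linarith
        · have : ((|2 * e + 1 - k * (2 * Y)| : ℤ) : ℝ) ≤ (|Y| : ℤ) := by exact_mod_cast hlt
          have : (3 : ℝ) ≤ (|Y| : ℤ) := by exact_mod_cast h3
          nlinarith
    have hYabs : |(Y : ℝ)| = 1 := by exact_mod_cast hY1
    have hYY : Y * Y = 1 := by
      rw [← abs_mul_abs_self, hY1, one_mul]
    have hcol : ∀ f : ℤ, IsCol (Real.sqrt 2 * f) Y := fun f =>
      IsCol.of_det_right (-Y) 0 (by linarith)
    refine bound_of_det_sqrt_two hq hqq' hl ?_ (fun hlt => ?_) (fun hlt => ?_) hne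
    · rw [hdet', abs_neg, abs_mul, abs_of_pos hspos, hYabs, mul_one]
    · have hh : ∀ u v : ℝ, ((((2 * e + 1 : ℤ) : ℝ) * u + Real.sqrt 2 * Y * v) - u) / Real.sqrt 2 =
          Real.sqrt 2 * e * u + Y * v := fun u v => by
        rw [div_eq_iff hspos.ne']
        push_cast
        linear_combination (-e * u) * hs
      rw [hh] at hlt ⊢
      exact hbox _ _ (hcol e) hlt
    · have hh : ∀ u v : ℝ, ((((2 * e + 1 : ℤ) : ℝ) * u + Real.sqrt 2 * Y * v) + u) / Real.sqrt 2 =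
          Real.sqrt 2 * (e + 1 : ℤ) * u + Y * v := fun u v => by
        rw [div_eq_iff hspos.ne']
        push_cast
        linear_combination (-(e + 1) * u) * hs
      rw [hh] at hlt ⊢
      exact hbox _ _ (hcol (e + 1)) hlt
  · have hY : Odd (b * Y) := ⟨X * d - 1, by linarith⟩
    rw [Int.odd_mul] at hY
    obtain ⟨j, hj⟩ := hY.2
    obtain ⟨k, hk⟩ := Int.exists_two_mul_abs_sub_mul_le X (m := Y) (by omega)
    have hY1 : |Y| = 1 := by
      by_contra hY1
      refine hsmall (Real.sqrt 2 * (X - k * Y : ℤ)) _ (hshift k) ?_ ?_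
      · push_cast
        ring
      · have hY3 : 3 ≤ |Y| := by
          rcases abs_cases Y with h | h <;> omega
        have hlt : 2 * |X - k * Y| ≤ |Y| - 1 := by
          rcases abs_cases Y with h | h <;> omega
        rw [abs_mul, abs_of_pos hspos, ← Int.cast_abs, ← Int.cast_abs]
        have h4 : 2 * ((|X - k * Y| : ℤ) : ℝ) ≤ (|Y| : ℤ) - 1 := by exact_mod_cast hlt
        have h5 : (3 : ℝ) ≤ (|Y| : ℤ) := by exact_mod_cast hY3
        have h6 : (0 : ℝ) ≤ (|X - k * Y| : ℤ) := by exact_mod_cast abs_nonneg _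
        nlinarith [sqrt_two_lt]
    have hYabs : |(Y : ℝ)| = 1 := by exact_mod_cast hY1
    have hYY : Y * Y = 1 := by
      rw [← abs_mul_abs_self, hY1, one_mul]
    refine bound_of_det_one hq hqq' hl ?_ (fun hlt => ?_) (fun hlt => ?_) hne
    · rw [hdet', abs_neg, hYabs]
    · have hh : ∀ u v : ℝ, (Real.sqrt 2 * X * u + Y * v) - Real.sqrt 2 * u =
          Real.sqrt 2 * (X - 1 : ℤ) * u + Y * v := fun u v => by
        push_cast
        ring
      rw [hh] at hlt ⊢
      exact hbox _ _ (IsCol.of_det_right (-Y) 0 (by linarith)) hlt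
    · have hh : ∀ u v : ℝ, Real.sqrt 2 * (Real.sqrt 2 * X * u + Y * v) - u =
          (2 * X - 1 : ℤ) * u + Real.sqrt 2 * Y * v := fun u v => by
        push_cast
        linear_combination X * u * hs
      rw [hh] at hlt ⊢
      exact hbox _ _ (IsCol.of_det_left (Y * (X - 1)) 1 (by linear_combination (-2 * (X - 1)) * hYY))
        hlt

lemma IsCol.one_le_abs {x y : ℝ} (h : IsCol x y) (hy : y ≠ 0) : 1 ≤ |y| := by
  rcases hy.lt_or_gt with hneg | hpos
  · rw [abs_of_neg hneg]
    exact h.neg.one_le_of_pos (by linarith)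
  · rw [abs_of_pos hpos]
    exact h.one_le_of_pos hpos

theorem consecutive_bound (α : ℝ) (hα : 0 < α) (hirr : NotSqrt2Rat α)
    (p q p' q' : ℝ) (hcons : Consecutive α p q p' q') :
    1 / 2 < q' * |q * α - p| ∧ q' * |q * α - p| < (Real.sqrt 2 + 1) / 2 := by
  have hbox := fun r s h => hcons.abs_le (r := r) (s := s) h
  obtain ⟨hb, hb', hqq', -⟩ := hcons
  obtain ⟨hq, r, s, hM⟩ := qH4_iff.1 hb.1
  obtain ⟨hq', hcol'⟩ := qH4_iff.1 hb'.1
  have hdet := hM.det_eq_one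
  have hxy := hM.inv.mul_col hcol'
  obtain ⟨x, hx⟩ : ∃ x, x = s * p' + -r * q' := ⟨_, rfl⟩
  obtain ⟨y, hy⟩ : ∃ y, y = -q * p' + p * q' := ⟨_, rfl⟩
  rw [← hx, ← hy] at hxy
  have hp'e : p' = x * p + y * r := by
    rw [hx, hy]
    linear_combination (-p') * hdet
  have hq'e : q' = x * q + y * s := by
    rw [hx, hy]
    linear_combination (-q') * hdet
  have hy0 : y ≠ 0 := by
    intro hy0
    rcases hxy.left_of_right_zero hy0 with h | h <;> rw [h, hy0] at hq'e <;> linarith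
  have hl'e : q' * α - p' = x * (q * α - p) + y * (s * α - r) := by
    rw [hp'e, hq'e]
    ring
  have hl : |q' * α - p'| < |q * α - p| := by
    refine hb'.2 p q hb.1 ?_ hqq'.le
    rw [Ne, div_eq_div_iff hq.ne' hq'.ne']
    intro h
    exact hy0 (by rw [hy]; linear_combination h)
  refine ⟨?_, ?_⟩
  · have h₁ := hxy.one_le_abs hy0
    have h₂ : |y| ≤ q' * |q * α - p| + q * |q' * α - p'| := by
      have e : y = q * (q' * α - p') - q' * (q * α - p) := by
        rw [hy]
        ring
      rw [e, add_comm]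
      refine (abs_sub _ _).trans_eq ?_
      rw [abs_mul, abs_mul, abs_of_pos hq, abs_of_pos hq']
    have h₃ : q * |q' * α - p'| < q' * |q * α - p| :=
      mul_lt_mul'' hqq' hl hq.le (abs_nonneg _)
    linarith
  · have hne := IsCol.ne_sqrt_two_sub_one_mul ⟨r, s, hM⟩ hcol' hq'.ne'
    rw [hl'e] at hl
    rw [hq'e] at hqq' hne hbox ⊢
    refine bound_of_empty_box (m := s * α - r) (by linear_combination hdet) hxy hq hqq' hl
      (fun x₁ y₁ h₁ hlt => ?_) hne
    have := hbox _ _ (hM.mul_col h₁) (by rwa [mul_comm q, mul_comm s])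
    convert this using 2
    ring
end

section
/- Let α > 0 be a real number with α ∉ √2·ℚ. If p/q and p'/q' are consecutive H₄-best approximations of α, then for every r/s ∈ ℚ(H₄) with 0 < s < q' one has |s·α − r| ≥ |q·α − p|; that is, the minimum of |s·α − r| over fractions r/s ∈ ℚ(H₄) with denominator less than q' is attained at p/q. -/
/-- Members of ℚ(H₄) are `a / (√2 c)` with `a` odd or `√2 a / c` with `c` odd, in lowest terms. -/
lemma QH4.exists_int_s11 {p q : ℝ} (h : QH4 p q) : 0 < q ∧ ∃ a c : ℤ, 0 < c ∧ IsCoprime a c ∧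
    ((Odd a ∧ p = a ∧ q = √2 * c) ∨ (Odd c ∧ p = √2 * a ∧ q = c)) := by
  obtain ⟨hq, r, s, h⟩ := h
  have h2 : (0 : ℝ) < √2 := by positivity
  refine ⟨hq, ?_⟩
  rcases h with (⟨a, b, c, d, ha, -, hdet, hp, -, hc, -⟩ | ⟨a, b, c, d, -, hoc, hdet, hp, -, hc, -⟩) |
    (⟨a, b, c, d, ha, -, hdet, hp, -, hc, -⟩ | ⟨a, b, c, d, -, hoc, hdet, hp, -, hc, -⟩)
  · refine ⟨a, c, ?_, ⟨d, -2 * b, by linarith⟩, .inl ⟨ha, hp, hc⟩⟩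
    rw [hc] at hq
    exact_mod_cast pos_of_mul_pos_right hq h2.le
  · refine ⟨a, c, ?_, ⟨2 * d, -b, by linarith⟩, .inr ⟨hoc, hp, hc⟩⟩
    rw [hc] at hq
    exact_mod_cast hq
  · have hc' : q = √2 * ((-c : ℤ) : ℝ) := by push_cast; linarith
    refine ⟨-a, -c, ?_, ⟨-d, 2 * b, by linarith⟩, .inl ⟨ha.neg, by push_cast; linarith, hc'⟩⟩
    rw [hc'] at hq
    exact_mod_cast pos_of_mul_pos_right hq h2.le
  · have hc' : q = ((-c : ℤ) : ℝ) := by push_cast; linarith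
    refine ⟨-a, -c, ?_, ⟨-(2 * d), b, by linarith⟩,
      .inr ⟨hoc.neg, by push_cast; linarith, hc'⟩⟩
    rw [hc'] at hq
    exact_mod_cast hq

lemma Int.eq_of_isCoprime_of_mul_eq_mul {a b c d : ℤ} (hb : 0 < b) (hd : 0 < d)
    (hab : IsCoprime a b) (hcd : IsCoprime c d) (h : a * d = c * b) : b = d :=
  Int.dvd_antisymm hb.le hd.le
    (hab.symm.dvd_of_dvd_mul_left ⟨c, by linarith⟩)
    (hcd.symm.dvd_of_dvd_mul_left ⟨a, by linarith⟩)

/-- A fraction in ℚ(H₄) determines its denominator. -/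
lemma QH4.den_eq {p q r s : ℝ} (h : QH4 p q) (h' : QH4 r s) (he : r / s = p / q) : s = q := by
  obtain ⟨hq, a, c, hc, hac, h⟩ := h.exists_int_s11
  obtain ⟨hs, a', c', hc', hac', h'⟩ := h'.exists_int_s11
  have h2 : (0 : ℝ) < √2 := by positivity
  have hsq : √2 * √2 = 2 := Real.mul_self_sqrt (by norm_num)
  rw [div_eq_div_iff hs.ne' hq.ne'] at he
  rcases h with ⟨ho, rfl, rfl⟩ | ⟨ho, rfl, rfl⟩ <;>
    rcases h' with ⟨ho', rfl, rfl⟩ | ⟨ho', rfl, rfl⟩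
  · have e : (a' * c : ℝ) = a * c' := mul_left_cancel₀ h2.ne' (by linarith)
    rw [Int.eq_of_isCoprime_of_mul_eq_mul hc' hc hac' hac (by exact_mod_cast e)]
  · exfalso
    have e : (2 * (a' * c) : ℝ) = a * c' := by linear_combination he - (a' * c : ℝ) * hsq
    have e' : 2 * (a' * c) = a * c' := by exact_mod_cast e
    exact Int.not_even_iff_odd.mpr (ho.mul ho') (e' ▸ even_two_mul _)
  · exfalso
    have e : (2 * (a * c') : ℝ) = a' * c := by linear_combination -he - (a * c' : ℝ) * hsq
    have e' : 2 * (a * c') = a' * c := by exact_mod_cast e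
    exact Int.not_even_iff_odd.mpr (ho'.mul ho) (e' ▸ even_two_mul _)
  · have e : (a' * c : ℝ) = a * c' := mul_left_cancel₀ h2.ne' (by linarith)
    rw [Int.eq_of_isCoprime_of_mul_eq_mul hc' hc hac' hac (by exact_mod_cast e)]

/-- For `α ∉ √2 ℚ`, fractions with equal denominators are at different distances from `α`. -/
lemma QH4.num_eq {α p r q : ℝ} (hirr : NotSqrt2Rat α) (h : QH4 p q) (h' : QH4 r q)
    (he : |q * α - p| = |q * α - r|) : p = r := by
  obtain ⟨hq, a, c, hc, -, h⟩ := h.exists_int_s11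
  obtain ⟨-, a', c', hc', -, h'⟩ := h'.exists_int_s11
  have hsq : √2 * √2 = 2 := Real.mul_self_sqrt (by norm_num)
  have hcR : (0 : ℝ) < c := by exact_mod_cast hc
  have hcR' : (0 : ℝ) < c' := by exact_mod_cast hc'
  rcases abs_eq_abs.mp he with he | he
  · linarith
  exfalso
  rcases h with ⟨-, rfl, hqc⟩ | ⟨-, rfl, hqc⟩ <;> rcases h' with ⟨-, rfl, hqc'⟩ | ⟨-, rfl, hqc'⟩
  · refine hirr ⟨(a + a') / (4 * c), ?_⟩
    push_cast
    rw [hqc] at he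
    field_simp
    linear_combination √2 * he - 2 * c * α * hsq
  · refine irrational_sqrt_two ⟨c' / c, ?_⟩
    push_cast
    rw [div_eq_iff hcR.ne']
    linarith
  · refine irrational_sqrt_two ⟨c / c', ?_⟩
    push_cast
    rw [div_eq_iff hcR'.ne']
    linarith
  · refine hirr ⟨(a + a') / (2 * c), ?_⟩
    push_cast
    rw [hqc] at he
    field_simp
    linear_combination he

lemma finite_QH4_of_lt (α M Q : ℝ) (hα : 0 < α) :
    {x : ℝ × ℝ | QH4 x.1 x.2 ∧ x.2 < Q ∧ |x.2 * α - x.1| < M}.Finite := by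
  set N : ℤ := ⌈Q * α + M + Q⌉ with hN
  have hNle : Q * α + M + Q ≤ N := Int.le_ceil _
  have hfin := (Set.finite_Icc (-N) N).prod (Set.finite_Icc (-N) N)
  refine ((hfin.image fun z : ℤ × ℤ ↦ ((z.1 : ℝ), √2 * (z.2 : ℝ))).union
    (hfin.image fun z : ℤ × ℤ ↦ (√2 * (z.1 : ℝ), (z.2 : ℝ)))).subset ?_
  rintro ⟨p, q⟩ ⟨h, hqQ, hM⟩
  obtain ⟨hq, a, c, hc, -, h⟩ := h.exists_int_s11
  simp only at hqQ hM hq h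
  have h1 : (1 : ℝ) ≤ √2 := Real.one_le_sqrt.mpr (by norm_num)
  have hcR : (0 : ℝ) < c := by exact_mod_cast hc
  have hM0 : 0 < M := (abs_nonneg _).trans_lt hM
  have hqα : q * α < Q * α := by gcongr
  have hqα0 : 0 < q * α := by positivity
  obtain ⟨hl, hu⟩ := abs_lt.mp hM
  have hp : |p| ≤ N := abs_le.mpr ⟨by linarith, by linarith⟩
  have hbound : |(a : ℝ)| ≤ |p| ∧ (c : ℝ) ≤ q := by
    rcases h with ⟨-, rfl, rfl⟩ | ⟨-, rfl, rfl⟩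
    · exact ⟨le_rfl, le_mul_of_one_le_left hcR.le h1⟩
    · rw [abs_mul, abs_of_pos (by linarith : (0 : ℝ) < √2)]
      exact ⟨le_mul_of_one_le_left (abs_nonneg _) h1, le_rfl⟩
  have ha : |a| ≤ N := by
    have := hbound.1.trans hp
    exact_mod_cast this
  have hcN : c ≤ N := by
    have : (c : ℝ) ≤ N := by linarith [hbound.2]
    exact_mod_cast this
  have hmem : (a, c) ∈ Set.Icc (-N) N ×ˢ Set.Icc (-N) N :=
    ⟨abs_le.mp ha, by simp only; omega, hcN⟩
  rcases h with ⟨-, rfl, rfl⟩ | ⟨-, rfl, rfl⟩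
  · exact .inl ⟨(a, c), hmem, rfl⟩
  · exact .inr ⟨(a, c), hmem, rfl⟩

theorem min_attained (α : ℝ) (hα : 0 < α) (hirr : NotSqrt2Rat α)
    (p q p' q' : ℝ) (hcons : Consecutive α p q p' q')
    (r s : ℝ) (hrs : QH4 r s) (hs : s < q') :
    |q * α - p| ≤ |s * α - r| := by
  obtain ⟨⟨hpq, hbest⟩, -, -, hnone⟩ := hcons
  by_contra! hlt
  have hfin := finite_QH4_of_lt α |q * α - p| q' hα
  obtain ⟨⟨r₀, s₀⟩, ⟨h₀, hs₀, hM₀⟩, hmin⟩ := Set.exists_min_image _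
    (fun x : ℝ × ℝ ↦ toLex (x.2, |x.2 * α - x.1|)) hfin ⟨(r, s), hrs, hs, hlt⟩
  simp only at h₀ hs₀ hM₀
  refine hnone r₀ s₀ ⟨h₀, fun u v huv hne hle ↦ ?_⟩ ⟨?_, hs₀⟩
  · by_contra! hcon
    have hmin' := hmin (u, v) ⟨huv, hle.trans_lt hs₀, hcon.trans_lt hM₀⟩
    rw [Prod.Lex.toLex_le_toLex] at hmin'
    rcases hmin' with hv | ⟨hv, hval⟩
    · exact absurd hle hv.not_ge
    · simp only at hv hval
      subst hv
      exact hne (by rw [h₀.num_eq hirr huv (le_antisymm hval hcon)])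
  · by_contra! hle
    by_cases he : r₀ / s₀ = p / q
    · have hsq := hpq.den_eq h₀ he
      subst hsq
      rw [div_left_inj' hpq.1.ne'] at he
      subst he
      exact lt_irrefl _ hM₀
    · exact lt_asymm hM₀ (hbest r₀ s₀ h₀ he hle)
end
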